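/- Let q ≥ 3 be an integer and λ = 2·cos(π/q). For every G_q-irrational x ∈ [−λ/2, λ/2) and every n ≥ 1 one has Θ_{n−1}(x) = v_n/(1 + t_n·v_n) and Θ_n(x) = ε_{n+1}·t_n/(1 + t_n·v_n). -/

import Mathlib

noncomputable section

open Real Filter Topology MeasureTheory
open scoped Classical

namespace RosenTong

/-- `λ_q = 2 cos(π/q)`. -/
def lam (q : ℕ) : ℝ := 2 * Real.cos (Real.pi / q)

/-- The Rosen map `f_q` on `[-λ/2, λ/2)`. -/
def f (l : ℝ) (x : ℝ) : ℝ :=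
  if x = 0 then 0 else 1 / |x| - l * (⌊1 / (l * |x|) + 1 / 2⌋ : ℝ)

/-- `x` is `G_q`-irrational: its Rosen orbit never hits `0`. -/
def Irr (l : ℝ) (x : ℝ) : Prop := ∀ n : ℕ, (f l)^[n] x ≠ 0

/-- `ε_n = sign (f^{n-1} x)` (for `n ≥ 1`). -/
def eps (l x : ℝ) (n : ℕ) : ℝ := Real.sign ((f l)^[n - 1] x)

/-- `r_n = ⌊1/(λ |f^{n-1} x|) + 1/2⌋` (for `n ≥ 1`), as a real number. -/
def rr (l x : ℝ) (n : ℕ) : ℝ := (⌊1 / (l * |(f l)^[n - 1] x|) + 1 / 2⌋ : ℝ)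

/-- `((R_{n-1}, R_n), (S_{n-1}, S_n))`. -/
def RS (l x : ℝ) : ℕ → (ℝ × ℝ) × (ℝ × ℝ)
  | 0 => ((1, 0), (0, 1))
  | n + 1 =>
      (((RS l x n).1.2, rr l x (n + 1) * l * (RS l x n).1.2 + eps l x (n + 1) * (RS l x n).1.1),
       ((RS l x n).2.2, rr l x (n + 1) * l * (RS l x n).2.2 + eps l x (n + 1) * (RS l x n).2.1))

/-- Numerator `R_n` of the `n`-th Rosen convergent. -/
def Rnum (l x : ℝ) (n : ℕ) : ℝ := (RS l x n).1.2

/-- Denominator `S_n` of the `n`-th Rosen convergent. -/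
def Snum (l x : ℝ) (n : ℕ) : ℝ := (RS l x n).2.2

/-- The approximation coefficient `Θ_n = S_n² |x - R_n/S_n|`. -/
def theta (l x : ℝ) (n : ℕ) : ℝ := (Snum l x n) ^ 2 * |x - Rnum l x n / Snum l x n|

/-- The natural extension map `𝒯(x,y) = (f x, 1/(r(x)λ + ε(x) y))`. -/
def T (l : ℝ) (z : ℝ × ℝ) : ℝ × ℝ :=
  (f l z.1, 1 / ((⌊1 / (l * |z.1|) + 1 / 2⌋ : ℝ) * l + Real.sign z.1 * z.2))

/-- `(t_n, v_n) = 𝒯^n (x, 0)`. -/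
def tv (l x : ℝ) (n : ℕ) : ℝ × ℝ := (T l)^[n] (x, 0)

/-- `G(y) = -1/(λ + y)`. -/
def G (l : ℝ) (y : ℝ) : ℝ := -1 / (l + y)

/-- `C(y) = -1/(2λ + y)`. -/
def CC (l : ℝ) (y : ℝ) : ℝ := -1 / (2 * l + y)

/-- `τ_k` in the even case `q = 2p`. -/
def tauE (l : ℝ) (p : ℕ) : ℕ → ℝ
  | 0 => -2 / (3 * l)
  | k + 1 => -1 / (2 * l + (G l)^[p - 2] (tauE l p k))

/-- `τ_k` in the odd case `q = 2h+3`. -/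
def tauO (l : ℝ) (h : ℕ) : ℕ → ℝ
  | 0 => -2 / (3 * l)
  | k + 1 => CC l ((G l)^[h] (CC l ((G l)^[h - 1] (tauO l h k))))

/-- `φ_j = f^j(-λ/2)`. -/
def phi (l : ℝ) (j : ℕ) : ℝ := (f l)^[j] (-(l / 2))

/-- The heights `L_j` in the even case: `L_1 = 1/(λ+1)`, `L_j = 1/(λ - L_{j-1})`. -/
def LE (l : ℝ) : ℕ → ℝ
  | 0 => 0
  | 1 => 1 / (l + 1)
  | j + 2 => 1 / (l - LE l (j + 1))

/-- The natural extension domain `Ω` in the even case `q = 2p`. -/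
def OmegaE (l : ℝ) (p : ℕ) : Set (ℝ × ℝ) :=
  (⋃ j ∈ Finset.Icc 1 (p - 1),
    (Set.Ico (phi l (j - 1)) (phi l j)) ×ˢ (Set.Icc 0 (LE l j)))
  ∪ (Set.Ico (0 : ℝ) (l / 2)) ×ˢ (Set.Icc (0 : ℝ) 1)

/-- The region `D` (even case): both `Θ_{n-1}` and `Θ_n` exceed `1/2`. -/
def DE (l : ℝ) (p : ℕ) : Set (ℝ × ℝ) :=
  {z ∈ OmegaE l p | z.2 / (1 + z.1 * z.2) > 1 / 2 ∧ |z.1| / (1 + z.1 * z.2) > 1 / 2}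

/-- The region `A = {(t,v) ∈ D : -2/(3λ) ≤ t ≤ -1/(λ+1)}`. -/
def AE (l : ℝ) (p : ℕ) : Set (ℝ × ℝ) :=
  {z ∈ DE l p | -2 / (3 * l) ≤ z.1 ∧ z.1 ≤ -1 / (l + 1)}

/-- `A_k = {(t,v) ∈ A : t ≥ τ_k}`. -/
def AEk (l : ℝ) (p k : ℕ) : Set (ℝ × ℝ) :=
  {z ∈ AE l p | tauE l p k ≤ z.1}

/-- The invariant measure `ν` (even case), with density `C_q/(1+tv)²` on `Ω`. -/
def nuE (q p : ℕ) : Measure (ℝ × ℝ) :=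
  (volume.restrict (OmegaE (lam q) p)).withDensity fun z =>
    ENNReal.ofReal
      ((1 / Real.log ((1 + Real.cos (Real.pi / q)) / Real.sin (Real.pi / q))) /
        (1 + z.1 * z.2) ^ 2)

/-- The Hurwitz constant `H_q` for odd `q`. -/
def Hodd (l : ℝ) : ℝ := 1 / (2 * Real.sqrt ((1 - l / 2) ^ 2 + 1) )

/-- The positive root `R` of `R² + (2-λ)R - 1 = 0` (odd case). -/
def Rodd (l : ℝ) : ℝ := (l - 2 + Real.sqrt ((2 - l) ^ 2 + 4)) / 2

/-- A set containing every point `(t_n, v_n)`, on which the denominators `r λ + ε v` of the natural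
extension map are positive. For `λ = 1` all partial quotients are at least `2` and `v ≤ 1` is
enough. For `λ ≥ √2` the bound for `t < 0` says that `(-t, v)` lies below the curve
`λ (w + v) - (λ² - 2) w v = 2`, which is preserved by `(w, v) ↦ (λ - 1/w, 1/(λ - v))`. -/
def Inv (l : ℝ) (z : ℝ × ℝ) : Prop :=
  -(l / 2) ≤ z.1 ∧ z.1 < l / 2 ∧ 0 ≤ z.2 ∧
    (l = 1 → z.2 ≤ 1) ∧ (l ≠ 1 → z.1 < 0 → l * (z.2 - z.1) + (l ^ 2 - 2) * (z.1 * z.2) ≤ 2)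

lemma one_eq_or_two_le_sq_lam {q : ℕ} (hq : 3 ≤ q) :
    0 < lam q ∧ lam q < 2 ∧ (lam q = 1 ∨ lam q ≠ 1 ∧ 2 ≤ lam q ^ 2) := by
  have hpi := Real.pi_pos
  have hq' : (3 : ℝ) ≤ q := by exact_mod_cast hq
  have h0 : 0 < Real.pi / q := by positivity
  have hlt : lam q < 2 := by
    have h := Real.cos_lt_cos_of_nonneg_of_le_pi le_rfl
      (div_le_self hpi.le (by linarith : (1 : ℝ) ≤ q)) h0
    rw [Real.cos_zero] at h
    unfold lam
    linarith
  rcases hq.eq_or_lt with rfl | hq4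
  · have h1 : lam 3 = 1 := by simp [lam]
    rw [h1]
    norm_num
  · have hq4' : (4 : ℝ) ≤ q := by exact_mod_cast hq4
    have hle : Real.pi / q ≤ Real.pi / 4 := by gcongr
    have h := Real.cos_le_cos_of_nonneg_of_le_pi h0.le (by linarith) hle
    rw [Real.cos_pi_div_four] at h
    have hs : √2 ≤ lam q := by unfold lam; linarith
    have hs1 : 1 < √(2 : ℝ) := by rw [Real.lt_sqrt] <;> norm_num
    have hs2 : √(2 : ℝ) ^ 2 = 2 := Real.sq_sqrt (by norm_num)
    exact ⟨by linarith, hlt, Or.inr ⟨by linarith, by nlinarith⟩⟩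

lemma f_eq {l t : ℝ} (ht : t ≠ 0) : f l t = 1 / |t| - l * (⌊1 / (l * |t|) + 1 / 2⌋ : ℝ) :=
  if_neg ht

lemma f_mem_Ico {l t : ℝ} (hl : 0 < l) (ht : t ≠ 0) :
    -(l / 2) ≤ f l t ∧ f l t < l / 2 := by
  have hat : 0 < |t| := abs_pos.mpr ht
  have h1 := Int.floor_le (1 / (l * |t|) + 1 / 2)
  have h2 := Int.lt_floor_add_one (1 / (l * |t|) + 1 / 2)
  have e : 1 / |t| = l * (1 / (l * |t|)) := by field_simp
  rw [f_eq ht, e, ← mul_sub]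
  constructor <;> nlinarith

lemma one_le_floor {l t : ℝ} (hl : 0 < l) (hl2 : l < 2) (ht : t ≠ 0) (h1 : -(l / 2) ≤ t)
    (h2 : t < l / 2) : 1 ≤ ⌊1 / (l * |t|) + 1 / 2⌋ := by
  have hat : 0 < |t| := abs_pos.mpr ht
  have hle : |t| ≤ l / 2 := abs_le.mpr ⟨h1, h2.le⟩
  have h : 1 / 2 ≤ 1 / (l * |t|) := one_div_le_one_div_of_le (by positivity) (by nlinarith)
  rw [Int.le_floor]
  push_cast
  linarith

lemma two_le_floor {t : ℝ} (ht : t ≠ 0) (h1 : -(1 / 2) ≤ t) (h2 : t < 1 / 2) :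
    2 ≤ ⌊1 / (1 * |t|) + 1 / 2⌋ := by
  have hat : 0 < |t| := abs_pos.mpr ht
  have hle : |t| ≤ 1 / 2 := abs_le.mpr ⟨h1, h2.le⟩
  have h : 2 ≤ 1 / (1 * |t|) := by
    rw [one_mul, le_div_iff₀ hat]
    linarith
  rw [Int.le_floor]
  push_cast
  linarith

lemma sign_mul_self (t : ℝ) : Real.sign t * t = |t| := by
  rcases lt_trichotomy t 0 with h | rfl | h
  · rw [Real.sign_of_neg h, abs_of_neg h]; ring
  · simp
  · rw [Real.sign_of_pos h, abs_of_pos h]; ring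

/-- Points with `v ≤ 1/λ` satisfy the defining bound of `Inv`. -/
lemma bound_of_mul_le_one {l t v : ℝ} (hl : 0 < l) (hl2 : l < 2) (hsq : 2 ≤ l ^ 2)
    (h1 : -(l / 2) ≤ t) (hv : l * v ≤ 1) :
    l * (v - t) + (l ^ 2 - 2) * (t * v) ≤ 2 := by
  have hc : 0 ≤ l - (l ^ 2 - 2) * v := by
    have : (l ^ 2 - 2) * (l * v) ≤ (l ^ 2 - 2) * 1 :=
      mul_le_mul_of_nonneg_left hv (by linarith)
    by_contra hneg
    push Not at hneg
    nlinarith [mul_neg_of_pos_of_neg hl hneg]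
  have hA : 0 ≤ (t + l / 2) * (l - (l ^ 2 - 2) * v) := mul_nonneg (by linarith) hc
  have hB : 0 ≤ (1 - l * v) * (4 - l ^ 2) := mul_nonneg (by linarith) (by nlinarith)
  nlinarith

lemma mul_lt_two_of_bound {l t v : ℝ} (hl : 0 < l) (hl2 : l < 2) (hsq : 2 ≤ l ^ 2)
    (h1 : -(l / 2) ≤ t) (ht : t < 0)
    (hb : l * (v - t) + (l ^ 2 - 2) * (t * v) ≤ 2) : l * v < 2 := by
  have hq : 0 < 4 - l ^ 2 := by nlinarith
  by_contra hv
  push Not at hv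
  have hc : 0 ≤ l ^ 2 + (l ^ 2 - 2) * (l * t) := by
    have : 0 ≤ (l ^ 2 - 2) * (l * (t + l / 2)) :=
      mul_nonneg (by linarith) (mul_nonneg hl.le (by linarith))
    nlinarith [mul_nonneg (sq_nonneg l) hq.le]
  have hA : 0 ≤ (l * v - 2) * (l ^ 2 + (l ^ 2 - 2) * (l * t)) :=
    mul_nonneg (by linarith) hc
  have hC : 0 < -(l * t) * (4 - l ^ 2) := mul_pos (by nlinarith) hq
  have hD := mul_le_mul_of_nonneg_left hb (sq_nonneg l)
  nlinarith

lemma Inv.step {l : ℝ} (hl : 0 < l) (hl2 : l < 2) (hcase : l = 1 ∨ l ≠ 1 ∧ 2 ≤ l ^ 2)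
    {z : ℝ × ℝ} (hz : Inv l z) (ht : z.1 ≠ 0) :
    0 < (⌊1 / (l * |z.1|) + 1 / 2⌋ : ℝ) * l + Real.sign z.1 * z.2 ∧ Inv l (T l z) := by
  obtain ⟨t, v⟩ := z
  obtain ⟨h1, h2, hv, hone, hne⟩ := hz
  simp only at h1 h2 hv hone hne ht ⊢
  have hf := f_mem_Ico hl ht
  rcases hcase with rfl | ⟨hl1, hsq⟩
  · have hr := two_le_floor ht h1 h2
    have hr' : (2 : ℝ) ≤ (⌊1 / (1 * |t|) + 1 / 2⌋ : ℝ) := by exact_mod_cast hr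
    have hd : 1 ≤ (⌊1 / (1 * |t|) + 1 / 2⌋ : ℝ) * 1 + Real.sign t * v := by
      have hv1 := hone rfl
      rcases Real.sign_apply_eq_of_ne_zero t ht with h | h <;> rw [h] <;> linarith
    refine ⟨by linarith, hf.1, hf.2, ?_, fun _ => ?_, fun h => absurd rfl h⟩
    · exact one_div_nonneg.mpr (by linarith)
    · exact (div_le_one (by linarith)).mpr hd
  · have hr := one_le_floor hl hl2 ht h1 h2
    have hfe := f_eq (l := l) ht
    simp only [T, Inv]
    set k := ⌊1 / (l * |t|) + 1 / 2⌋
    have hr' : (1 : ℝ) ≤ k := by exact_mod_cast hr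
    have large : ∀ d : ℝ, l ≤ d → 0 < d ∧ -(l / 2) ≤ f l t ∧ f l t < l / 2 ∧ 0 ≤ 1 / d ∧
        (l = 1 → 1 / d ≤ 1) ∧ (l ≠ 1 → f l t < 0 →
          l * (1 / d - f l t) + (l ^ 2 - 2) * (f l t * (1 / d)) ≤ 2) := by
      intro d hd
      have hd0 : 0 < d := by linarith
      refine ⟨hd0, hf.1, hf.2, by positivity, fun h => absurd h hl1, fun _ _ => ?_⟩
      refine bound_of_mul_le_one hl hl2 hsq hf.1 ?_
      rw [mul_one_div]
      exact (div_le_one hd0).mpr hd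
    rcases lt_or_gt_of_ne ht with hneg | hpos
    · rw [Real.sign_of_neg hneg]
      have hb := hne hl1 hneg
      have hlv := mul_lt_two_of_bound hl hl2 hsq h1 hneg hb
      have hvl : v < l := by nlinarith
      rcases hr.eq_or_lt with hk | hk
      · rw [← hk] at hfe ⊢
        rw [abs_of_neg hneg] at hfe
        have hd0 : 0 < l - v := by linarith
        have hden : ((1 : ℤ) : ℝ) * l + -1 * v = l - v := by push_cast; ring
        rw [hden]
        refine ⟨hd0, hf.1, hf.2, by positivity, fun h => absurd h hl1, fun _ _ => ?_⟩
        have hw : 0 < -t := by linarith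
        have key : 2 - (l * (1 / (l - v) - f l t) + (l ^ 2 - 2) * (f l t * (1 / (l - v)))) =
            (2 - (l * (v - t) + (l ^ 2 - 2) * (t * v))) / (-t * (l - v)) := by
          rw [hfe]
          push_cast
          field_simp
          ring
        have : 0 ≤ (2 - (l * (v - t) + (l ^ 2 - 2) * (t * v))) / (-t * (l - v)) :=
          div_nonneg (by linarith) (by positivity)
        linarith
      · have hk2 : (2 : ℝ) ≤ k := by exact_mod_cast hk
        exact large _ (by nlinarith)
    · rw [Real.sign_of_pos hpos]
      exact large _ (by nlinarith)

lemma tv_succ (l x : ℝ) (n : ℕ) : tv l x (n + 1) = T l (tv l x n) :=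
  Function.iterate_succ_apply' _ _ _

lemma tv_fst (l x : ℝ) (n : ℕ) : (tv l x n).1 = (f l)^[n] x := by
  induction n with
  | zero => rfl
  | succ n ih =>
    rw [tv_succ, Function.iterate_succ_apply', ← ih]
    rfl

/-- The matrix identities linking the convergents with the natural extension orbit. -/
lemma convergents_invariant {l x : ℝ} (hl : 0 < l) (hl2 : l < 2)
    (hcase : l = 1 ∨ l ≠ 1 ∧ 2 ≤ l ^ 2)
    (hx : x ∈ Set.Ico (-(l / 2)) (l / 2)) (hirr : Irr l x) (n : ℕ) :
    Inv l (tv l x n) ∧ 0 < (RS l x n).2.2 ∧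
      (tv l x n).2 * (RS l x n).2.2 = (RS l x n).2.1 ∧
      0 < (RS l x n).2.2 + (tv l x n).1 * (RS l x n).2.1 ∧
      x * ((RS l x n).2.2 + (tv l x n).1 * (RS l x n).2.1) =
        (RS l x n).1.2 + (tv l x n).1 * (RS l x n).1.1 ∧
      |(RS l x n).1.1 * (RS l x n).2.2 - (RS l x n).1.2 * (RS l x n).2.1| = 1 := by
  induction n with
  | zero =>
    refine ⟨⟨hx.1, hx.2, le_rfl, fun _ => zero_le_one, fun h1 _ => ?_⟩, ?_⟩
    · exact bound_of_mul_le_one hl hl2 (hcase.resolve_left h1).2 hx.1 (by simp [tv])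
    · simp [RS, tv]
  | succ n ih =>
    obtain ⟨hI, hS, hv, hP, hxe, hdet⟩ := ih
    have ht : (tv l x n).1 ≠ 0 := by rw [tv_fst]; exact hirr n
    obtain ⟨hd, hI'⟩ := hI.step hl hl2 hcase ht
    have hf := f_eq (l := l) ht
    have he : eps l x (n + 1) = Real.sign (tv l x n).1 := by rw [tv_fst]; rfl
    have hr : rr l x (n + 1) = (⌊1 / (l * |(tv l x n).1|) + 1 / 2⌋ : ℝ) := by rw [tv_fst]; rfl
    have hsg := sign_mul_self (tv l x n).1
    have hsq := Real.sign_apply_eq_of_ne_zero _ ht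
    have hat : 0 < |(tv l x n).1| := abs_pos.mpr ht
    refine ⟨tv_succ l x n ▸ hI', ?_⟩
    simp only [tv_succ, RS, he, hr, T]
    generalize (⌊1 / (l * |(tv l x n).1|) + 1 / 2⌋ : ℝ) = k at *
    generalize (tv l x n).1 = t at *
    generalize (tv l x n).2 = v at *
    generalize Real.sign t = e at *
    generalize RS l x n = m at *
    obtain ⟨⟨R', R⟩, ⟨S', S⟩⟩ := m
    simp only at hS hv hP hxe hdet ⊢
    have hcomb : ∀ a b : ℝ, k * l * a + e * b + f l t * a = (a + t * b) / |t| := by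
      intro a b
      have hee : e * |t| = t := by
        rcases hsq with h | h <;> rw [h] at hsg ⊢ <;> linarith
      rw [hf, eq_div_iff hat.ne']
      have : 1 / |t| * |t| = 1 := one_div_mul_cancel hat.ne'
      linear_combination a * this + b * hee
    have hSn : k * l * S + e * S' = (k * l + e * v) * S := by rw [← hv]; ring
    refine ⟨hSn ▸ mul_pos hd hS, ?_, ?_, ?_, ?_⟩
    · rw [hSn]; field_simp
    · rw [hcomb]; positivity
    · rw [hcomb, hcomb, ← hxe]; ring
    · have : R * (k * l * S + e * S') - (k * l * R + e * R') * S = -e * (R' * S - R * S') := by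
        ring
      rw [this, abs_mul, hdet]
      rcases hsq with h | h <;> rw [h] <;> norm_num

/-- `Θ_{n-1} = v_n/(1+t_n v_n)` and `Θ_n = ε_{n+1} t_n/(1+t_n v_n)`. -/
theorem theta_formulae (q : ℕ) (hq : 3 ≤ q)
    (x : ℝ) (hx : x ∈ Set.Ico (-(lam q / 2)) (lam q / 2)) (hirr : Irr (lam q) x)
    (n : ℕ) (hn : 1 ≤ n) :
    theta (lam q) x (n - 1) =
      (tv (lam q) x n).2 / (1 + (tv (lam q) x n).1 * (tv (lam q) x n).2) ∧
    theta (lam q) x n =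
      eps (lam q) x (n + 1) * (tv (lam q) x n).1 /
        (1 + (tv (lam q) x n).1 * (tv (lam q) x n).2) := by
  obtain ⟨hl, hl2, hcase⟩ := one_eq_or_two_le_sq_lam hq
  have he : eps (lam q) x (n + 1) * (tv (lam q) x n).1 = |(tv (lam q) x n).1| := by
    rw [tv_fst]
    exact sign_mul_self _
  obtain ⟨m, rfl⟩ : ∃ m, n = m + 1 := ⟨n - 1, by omega⟩
  have hS' : 0 < Snum (lam q) x m :=
    (convergents_invariant hl hl2 hcase hx hirr m).2.1
  obtain ⟨-, hS, hv, hP, hxe, hdet⟩ := convergents_invariant hl hl2 hcase hx hirr (m + 1)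
  have hSm : (RS (lam q) x (m + 1)).2.1 = Snum (lam q) x m := rfl
  have hRm : (RS (lam q) x (m + 1)).1.1 = Rnum (lam q) x m := rfl
  have hSn : (RS (lam q) x (m + 1)).2.2 = Snum (lam q) x (m + 1) := rfl
  have hRn : (RS (lam q) x (m + 1)).1.2 = Rnum (lam q) x (m + 1) := rfl
  rw [he]
  rw [hSm, hSn] at hv hP
  rw [hSn] at hS
  rw [hSm, hSn, hRm, hRn] at hxe hdet
  simp only [theta, Nat.add_sub_cancel]
  generalize Snum (lam q) x m = S' at *
  generalize Rnum (lam q) x m = R' at *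
  generalize Snum (lam q) x (m + 1) = S at *
  generalize Rnum (lam q) x (m + 1) = R at *
  generalize (tv (lam q) x (m + 1)).1 = t at *
  generalize (tv (lam q) x (m + 1)).2 = v at *
  have hv' : v = S' / S := by rw [← hv]; field_simp
  have h1 : 1 + t * v = (S + t * S') / S := by rw [hv']; field_simp
  have e1 : x - R' / S' = -(R' * S - R * S') / (S' * (S + t * S')) := by
    rw [eq_div_iff (by positivity)]
    field_simp
    linear_combination S' * hxe
  have e2 : x - R / S = t * (R' * S - R * S') / (S * (S + t * S')) := by
    rw [eq_div_iff (by positivity)]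
    field_simp
    linear_combination S * hxe
  rw [e1, e2, h1, hv']
  constructor
  · rw [abs_div, abs_neg, hdet, abs_of_pos (by positivity : 0 < S' * (S + t * S'))]
    field_simp
  · rw [abs_div, abs_mul, hdet, abs_of_pos (by positivity : 0 < S * (S + t * S'))]
    field_simp

end RosenTong
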